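/- Assume the quasimonotone assumptions hold for ordered upper and lower solutions Ũ, Û of the nonlinear difference scheme. Let Ū⁽¹⁾ be obtained from Ū⁽⁰⁾ = Ũ by one block Jacobi step, and let U̲⁽¹⁾ be obtained from U̲⁽⁰⁾ = Û by one block Jacobi step. Then Ū⁽¹⁾ and U̲⁽¹⁾ are again ordered upper and lower solutions of the nonlinear difference scheme; in particular U̲_α⁽¹⁾ ≤ Ū_α⁽¹⁾ at every mesh point, 𝓛_α Ū_α⁽¹⁾ + f_α(i,j,Ū₁⁽¹⁾,Ū₂⁽¹⁾) ≥ 0 and 𝓛_α U̲_α⁽¹⁾ + f_α(i,j,U̲₁⁽¹⁾,U̲₂⁽¹⁾) ≤ 0 at every interior point, for α = 1,2. -/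

import Mathlib

namespace BlockMonotone

/-- A rectangular mesh on the unit square with `Nx, Ny ≥ 2` subdivisions. -/
structure Mesh where
  Nx : ℕ
  Ny : ℕ
  hNx : 2 ≤ Nx
  hNy : 2 ≤ Ny

namespace Mesh

variable (M : Mesh)

/-- Mesh spacing in the x-direction. -/
noncomputable def hx : ℝ := 1 / (M.Nx : ℝ)

/-- Mesh spacing in the y-direction. -/
noncomputable def hy : ℝ := 1 / (M.Ny : ℝ)

/-- `(i,j)` is a mesh point. -/
def IsMeshPt (i j : ℕ) : Prop := i ≤ M.Nx ∧ j ≤ M.Ny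

/-- `(i,j)` is an interior mesh point. -/
def IsInterior (i j : ℕ) : Prop := 1 ≤ i ∧ i ≤ M.Nx - 1 ∧ 1 ≤ j ∧ j ≤ M.Ny - 1

/-- `(i,j)` is a boundary mesh point. -/
def IsBoundary (i j : ℕ) : Prop := M.IsMeshPt i j ∧ ¬ M.IsInterior i j

/-- Coefficient `l_α(i,j) = ε/hx² + v(i,j)/hx`. -/
noncomputable def lC (ε : ℝ) (v : ℕ → ℕ → ℝ) (i j : ℕ) : ℝ := ε / M.hx ^ 2 + v i j / M.hx

/-- Coefficient `r_α(i,j) = ε/hx²`. -/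
noncomputable def rC (ε : ℝ) : ℝ := ε / M.hx ^ 2

/-- Coefficient `b_α(i,j) = ε/hy² + v(i,j)/hy`. -/
noncomputable def bC (ε : ℝ) (v : ℕ → ℕ → ℝ) (i j : ℕ) : ℝ := ε / M.hy ^ 2 + v i j / M.hy

/-- Coefficient `t_α(i,j) = ε/hy²`. -/
noncomputable def tC (ε : ℝ) : ℝ := ε / M.hy ^ 2

/-- Coefficient `d_α(i,j) = l + r + b + t`. -/
noncomputable def dC (ε : ℝ) (v : ℕ → ℕ → ℝ) (i j : ℕ) : ℝ :=
  M.lC ε v i j + M.rC ε + M.bC ε v i j + M.tC ε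

/-- The discrete operator `𝓛 U(i,j)` at interior points. -/
noncomputable def discL (ε : ℝ) (v : ℕ → ℕ → ℝ) (U : ℕ → ℕ → ℝ) (i j : ℕ) : ℝ :=
  M.dC ε v i j * U i j - M.lC ε v i j * U (i - 1) j - M.rC ε * U (i + 1) j
    - M.bC ε v i j * U i (j - 1) - M.tC ε * U i (j + 1)

end Mesh

/-- Partial derivative of a two-variable real function in its first variable. -/
noncomputable def p1 (f : ℝ → ℝ → ℝ) (u₁ u₂ : ℝ) : ℝ := deriv (fun x => f x u₂) u₁

/-- Partial derivative of a two-variable real function in its second variable. -/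
noncomputable def p2 (f : ℝ → ℝ → ℝ) (u₁ u₂ : ℝ) : ℝ := deriv (fun y => f u₁ y) u₂

end BlockMonotone

open BlockMonotone

namespace BlockMonotone

theorem sub_le_of_deriv_le {f : ℝ → ℝ} (hf : Differentiable ℝ f) {C x y : ℝ} (hxy : x ≤ y)
    (hC : ∀ u, x ≤ u → u ≤ y → deriv f u ≤ C) : f y - f x ≤ C * (y - x) :=
  (convex_Icc x y).image_sub_le_mul_sub_of_deriv_le hf.continuous.continuousOn
    hf.differentiableOn (fun u hu => by
      rw [interior_Icc] at hu
      exact hC u hu.1.le hu.2.le)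
    x (Set.left_mem_Icc.2 hxy) y (Set.right_mem_Icc.2 hxy) hxy

/-- Integrating bounds on the partial derivatives along an axis-parallel path. -/
theorem sub_le_of_partial_le {f : ℝ → ℝ → ℝ} (hf₁ : ∀ u₂, Differentiable ℝ (fun x => f x u₂))
    (hf₂ : ∀ u₁, Differentiable ℝ (fun y => f u₁ y)) {A B x₁ x₂ y₁ y₂ : ℝ}
    (h₁ : x₁ ≤ y₁) (h₂ : x₂ ≤ y₂)
    (hA : ∀ u₁ u₂, x₁ ≤ u₁ → u₁ ≤ y₁ → x₂ ≤ u₂ → u₂ ≤ y₂ → p1 f u₁ u₂ ≤ A)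
    (hB : ∀ u₁ u₂, x₁ ≤ u₁ → u₁ ≤ y₁ → x₂ ≤ u₂ → u₂ ≤ y₂ → p2 f u₁ u₂ ≤ B) :
    f y₁ y₂ - f x₁ x₂ ≤ A * (y₁ - x₁) + B * (y₂ - x₂) := by
  have hfst := sub_le_of_deriv_le (hf₁ y₂) h₁ fun u hu hu' => hA u y₂ hu hu' h₂ le_rfl
  have hsnd := sub_le_of_deriv_le (hf₂ x₁) h₂ fun u hu hu' => hB x₁ u le_rfl h₁ hu hu'
  linarith

/-- Discrete minimum principle for a strictly diagonally dominant tridiagonal operator. -/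
theorem tridiagonal_nonneg {N : ℕ} {D B T W : ℕ → ℝ} (hB : ∀ j, 1 ≤ j → j + 1 ≤ N → 0 ≤ B j)
    (hT : ∀ j, 1 ≤ j → j + 1 ≤ N → 0 ≤ T j)
    (hD : ∀ j, 1 ≤ j → j + 1 ≤ N → B j + T j < D j)
    (hW : ∀ j, 1 ≤ j → j + 1 ≤ N → 0 ≤ D j * W j - B j * W (j - 1) - T j * W (j + 1))
    (hW₀ : 0 ≤ W 0) (hWN : 0 ≤ W N) {j : ℕ} (hj : j ≤ N) : 0 ≤ W j := by
  obtain ⟨m, hm, hmin⟩ := (Finset.range (N + 1)).exists_min_image W ⟨0, by simp⟩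
  have hmin' : ∀ k ≤ N, W m ≤ W k := fun k hk => hmin k (by simp; omega)
  refine le_trans ?_ (hmin' j hj)
  by_contra! hneg
  have hmN : m ≤ N := by simpa [Nat.lt_succ_iff] using hm
  have h0 : m ≠ 0 := by rintro rfl; linarith
  have h1 : m ≠ N := by rintro rfl; linarith
  have l1 : 1 ≤ m := by omega
  have l2 : m + 1 ≤ N := by omega
  have hb := mul_le_mul_of_nonneg_left (hmin' (m - 1) (by omega)) (hB m l1 l2)
  have ht := mul_le_mul_of_nonneg_left (hmin' (m + 1) l2) (hT m l1 l2)
  nlinarith [hW m l1 l2, hD m l1 l2]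

namespace Mesh

variable {M : Mesh} {ε : ℝ} {v : ℕ → ℕ → ℝ} {i j : ℕ}

theorem hx_pos (M : Mesh) : 0 < M.hx :=
  one_div_pos.2 (Nat.cast_pos.2 (by have := M.hNx; omega))

theorem hy_pos (M : Mesh) : 0 < M.hy :=
  one_div_pos.2 (Nat.cast_pos.2 (by have := M.hNy; omega))

theorem lC_pos (hε : 0 < ε) (hv : 0 ≤ v i j) : 0 < M.lC ε v i j := by
  have := M.hx_pos
  unfold lC
  positivity

theorem rC_pos (hε : 0 < ε) : 0 < M.rC ε := by
  have := M.hx_pos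
  unfold rC
  positivity

theorem bC_pos (hε : 0 < ε) (hv : 0 ≤ v i j) : 0 < M.bC ε v i j := by
  have := M.hy_pos
  unfold bC
  positivity

theorem tC_pos (hε : 0 < ε) : 0 < M.tC ε := by
  have := M.hy_pos
  unfold tC
  positivity

theorem IsInterior.isMeshPt (h : M.IsInterior i j) : M.IsMeshPt i j := by
  unfold IsInterior at h
  unfold IsMeshPt
  omega

theorem IsInterior.isMeshPt_left (h : M.IsInterior i j) : M.IsMeshPt (i - 1) j := by
  unfold IsInterior at h
  unfold IsMeshPt
  omega

theorem IsInterior.isMeshPt_right (h : M.IsInterior i j) : M.IsMeshPt (i + 1) j := by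
  unfold IsInterior at h
  unfold IsMeshPt
  omega

/-- The operator inverted in a block Jacobi step satisfies the minimum principle. -/
theorem nonneg_of_block_nonneg (hε : 0 < ε) (hv : ∀ i j, M.IsMeshPt i j → 0 ≤ v i j)
    {c W : ℕ → ℕ → ℝ} (hc : ∀ i j, M.IsMeshPt i j → 0 ≤ c i j)
    (hint : ∀ i j, M.IsInterior i j →
      0 ≤ M.dC ε v i j * W i j - M.bC ε v i j * W i (j - 1) - M.tC ε * W i (j + 1)
        + c i j * W i j)
    (hbd : ∀ i j, M.IsBoundary i j → 0 ≤ W i j) (hij : M.IsMeshPt i j) : 0 ≤ W i j := by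
  by_cases hI : M.IsInterior i j
  swap
  · exact hbd i j ⟨hij, hI⟩
  have hline : ∀ k, 1 ≤ k → k + 1 ≤ M.Ny → M.IsInterior i k := fun k h₁ h₂ =>
    ⟨hI.1, hI.2.1, h₁, by omega⟩
  refine tridiagonal_nonneg (D := fun k => M.dC ε v i k + c i k) (B := fun k => M.bC ε v i k)
    (T := fun _ => M.tC ε) (fun k h₁ h₂ => ?_) (fun _ _ _ => (tC_pos hε).le)
    (fun k h₁ h₂ => ?_) (fun k h₁ h₂ => ?_) (hbd i 0 ⟨⟨hij.1, Nat.zero_le _⟩, ?_⟩)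
    (hbd i M.Ny ⟨⟨hij.1, le_rfl⟩, ?_⟩) hij.2
  · exact (bC_pos hε (hv i k (hline k h₁ h₂).isMeshPt)).le
  · have hl := lC_pos (M := M) hε (hv i k (hline k h₁ h₂).isMeshPt)
    have hr := rC_pos (M := M) hε
    have := hc i k (hline k h₁ h₂).isMeshPt
    simp only [dC]
    linarith
  · have := hint i k (hline k h₁ h₂)
    linarith
  · exact fun h => absurd h.2.2.1 (by omega)
  · exact fun h => absurd h.2.2.2 (by have := M.hNy; omega)

end Mesh

end BlockMonotone

/-- After one block Jacobi step the iterates are again ordered upper and lower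
solutions of the nonlinear difference scheme. -/
theorem jacobi_first_step_upper_lower (M : Mesh)
    (ε : Fin 2 → ℝ) (hε : ∀ a, 0 < ε a)
    (v : Fin 2 → ℕ → ℕ → ℝ) (hv : ∀ a i j, M.IsMeshPt i j → 0 ≤ v a i j)
    (f : Fin 2 → ℕ → ℕ → ℝ → ℝ → ℝ) (g : Fin 2 → ℕ → ℕ → ℝ)
    (Utilde Uhat : Fin 2 → ℕ → ℕ → ℝ)
    (c : Fin 2 → ℕ → ℕ → ℝ)
    (hc : ∀ a i j, M.IsMeshPt i j → 0 ≤ c a i j)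
    (hdiff1 : ∀ a i j u₂, Differentiable ℝ (fun x => f a i j x u₂))
    (hdiff2 : ∀ a i j u₁, Differentiable ℝ (fun y => f a i j u₁ y))
    (hq1 : ∀ i j, M.IsMeshPt i j → ∀ u₁ u₂,
      Uhat 0 i j ≤ u₁ → u₁ ≤ Utilde 0 i j → Uhat 1 i j ≤ u₂ → u₂ ≤ Utilde 1 i j →
      p1 (f 0 i j) u₁ u₂ ≤ c 0 i j ∧ p2 (f 1 i j) u₁ u₂ ≤ c 1 i j)
    (hq2 : ∀ i j, M.IsMeshPt i j → ∀ u₁ u₂,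
      Uhat 0 i j ≤ u₁ → u₁ ≤ Utilde 0 i j → Uhat 1 i j ≤ u₂ → u₂ ≤ Utilde 1 i j →
      p2 (f 0 i j) u₁ u₂ ≤ 0 ∧ p1 (f 1 i j) u₁ u₂ ≤ 0)
    (hord : ∀ a i j, M.IsMeshPt i j → Uhat a i j ≤ Utilde a i j)
    (hupper : ∀ a i j, M.IsInterior i j →
      0 ≤ M.discL (ε a) (v a) (Utilde a) i j + f a i j (Utilde 0 i j) (Utilde 1 i j))
    (hlower : ∀ a i j, M.IsInterior i j →
      M.discL (ε a) (v a) (Uhat a) i j + f a i j (Uhat 0 i j) (Uhat 1 i j) ≤ 0)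
    (hbd : ∀ a i j, M.IsBoundary i j → Uhat a i j ≤ g a i j ∧ g a i j ≤ Utilde a i j)
    (Ubar1 Ulow1 : Fin 2 → ℕ → ℕ → ℝ)
    (hubstep : ∀ a i j, M.IsInterior i j →
      M.dC (ε a) (v a) i j * Ubar1 a i j - M.bC (ε a) (v a) i j * Ubar1 a i (j - 1)
          - M.tC (ε a) * Ubar1 a i (j + 1) + c a i j * Ubar1 a i j
        = M.lC (ε a) (v a) i j * Utilde a (i - 1) j + M.rC (ε a) * Utilde a (i + 1) j
          + c a i j * Utilde a i j - f a i j (Utilde 0 i j) (Utilde 1 i j))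
    (hubbd : ∀ a i j, M.IsBoundary i j → Ubar1 a i j = g a i j)
    (hlostep : ∀ a i j, M.IsInterior i j →
      M.dC (ε a) (v a) i j * Ulow1 a i j - M.bC (ε a) (v a) i j * Ulow1 a i (j - 1)
          - M.tC (ε a) * Ulow1 a i (j + 1) + c a i j * Ulow1 a i j
        = M.lC (ε a) (v a) i j * Uhat a (i - 1) j + M.rC (ε a) * Uhat a (i + 1) j
          + c a i j * Uhat a i j - f a i j (Uhat 0 i j) (Uhat 1 i j))
    (hlobd : ∀ a i j, M.IsBoundary i j → Ulow1 a i j = g a i j) :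
    (∀ a i j, M.IsMeshPt i j → Ulow1 a i j ≤ Ubar1 a i j)
    ∧ (∀ a i j, M.IsInterior i j →
        0 ≤ M.discL (ε a) (v a) (Ubar1 a) i j + f a i j (Ubar1 0 i j) (Ubar1 1 i j))
    ∧ (∀ a i j, M.IsInterior i j →
        M.discL (ε a) (v a) (Ulow1 a) i j + f a i j (Ulow1 0 i j) (Ulow1 1 i j) ≤ 0)
    ∧ (∀ a i j, M.IsBoundary i j → Ulow1 a i j ≤ g a i j ∧ g a i j ≤ Ubar1 a i j) := by
  have hf : ∀ a i j, M.IsMeshPt i j → ∀ x y : Fin 2 → ℝ, (∀ b, Uhat b i j ≤ x b) →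
      (∀ b, x b ≤ y b) → (∀ b, y b ≤ Utilde b i j) →
      f a i j (y 0) (y 1) - f a i j (x 0) (x 1) ≤ c a i j * (y a - x a) := by
    intro a i j hij x y hx hxy hy
    have hbox : ∀ u₁ u₂, x 0 ≤ u₁ → u₁ ≤ y 0 → x 1 ≤ u₂ → u₂ ≤ y 1 →
        Uhat 0 i j ≤ u₁ ∧ u₁ ≤ Utilde 0 i j ∧ Uhat 1 i j ≤ u₂ ∧ u₂ ≤ Utilde 1 i j :=
      fun u₁ u₂ h₁ h₂ h₃ h₄ =>
        ⟨(hx 0).trans h₁, h₂.trans (hy 0), (hx 1).trans h₃, h₄.trans (hy 1)⟩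
    have hq1' : ∀ u₁ u₂, x 0 ≤ u₁ → u₁ ≤ y 0 → x 1 ≤ u₂ → u₂ ≤ y 1 →
        p1 (f 0 i j) u₁ u₂ ≤ c 0 i j ∧ p2 (f 1 i j) u₁ u₂ ≤ c 1 i j := by
      intro u₁ u₂ h₁ h₂ h₃ h₄
      obtain ⟨k₁, k₂, k₃, k₄⟩ := hbox u₁ u₂ h₁ h₂ h₃ h₄
      exact hq1 i j hij u₁ u₂ k₁ k₂ k₃ k₄
    have hq2' : ∀ u₁ u₂, x 0 ≤ u₁ → u₁ ≤ y 0 → x 1 ≤ u₂ → u₂ ≤ y 1 →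
        p2 (f 0 i j) u₁ u₂ ≤ 0 ∧ p1 (f 1 i j) u₁ u₂ ≤ 0 := by
      intro u₁ u₂ h₁ h₂ h₃ h₄
      obtain ⟨k₁, k₂, k₃, k₄⟩ := hbox u₁ u₂ h₁ h₂ h₃ h₄
      exact hq2 i j hij u₁ u₂ k₁ k₂ k₃ k₄
    match a with
    | 0 =>
      have := sub_le_of_partial_le (hdiff1 0 i j) (hdiff2 0 i j) (hxy 0) (hxy 1)
        (fun u₁ u₂ h₁ h₂ h₃ h₄ => (hq1' u₁ u₂ h₁ h₂ h₃ h₄).1)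
        (fun u₁ u₂ h₁ h₂ h₃ h₄ => (hq2' u₁ u₂ h₁ h₂ h₃ h₄).1)
      linarith
    | 1 =>
      have := sub_le_of_partial_le (hdiff1 1 i j) (hdiff2 1 i j) (hxy 0) (hxy 1)
        (fun u₁ u₂ h₁ h₂ h₃ h₄ => (hq2' u₁ u₂ h₁ h₂ h₃ h₄).2)
        (fun u₁ u₂ h₁ h₂ h₃ h₄ => (hq1' u₁ u₂ h₁ h₂ h₃ h₄).2)
      linarith
  have hupp : ∀ a i j, M.IsMeshPt i j → Ubar1 a i j ≤ Utilde a i j := by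
    intro a i j hij
    refine sub_nonneg.1 (Mesh.nonneg_of_block_nonneg (W := fun i j => Utilde a i j - Ubar1 a i j)
      (hε a) (hv a) (hc a) (fun i j h => ?_) (fun i j h => ?_) hij)
    · have h₁ := hupper a i j h
      have h₂ := hubstep a i j h
      simp only [Mesh.discL] at h₁ ⊢
      linarith
    · rw [hubbd a i j h]
      exact sub_nonneg.2 (hbd a i j h).2
  have hlow : ∀ a i j, M.IsMeshPt i j → Uhat a i j ≤ Ulow1 a i j := by
    intro a i j hij
    refine sub_nonneg.1 (Mesh.nonneg_of_block_nonneg (W := fun i j => Ulow1 a i j - Uhat a i j)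
      (hε a) (hv a) (hc a) (fun i j h => ?_) (fun i j h => ?_) hij)
    · have h₁ := hlower a i j h
      have h₂ := hlostep a i j h
      simp only [Mesh.discL] at h₁ ⊢
      linarith
    · rw [hlobd a i j h]
      exact sub_nonneg.2 (hbd a i j h).1
  have hmid : ∀ a i j, M.IsMeshPt i j → Ulow1 a i j ≤ Ubar1 a i j := by
    intro a i j hij
    refine sub_nonneg.1 (Mesh.nonneg_of_block_nonneg (W := fun i j => Ubar1 a i j - Ulow1 a i j)
      (hε a) (hv a) (hc a) (fun i j h => ?_) (fun i j h => ?_) hij)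
    · have h₁ := hubstep a i j h
      have h₂ := hlostep a i j h
      have h₃ := hf a i j h.isMeshPt (fun b => Uhat b i j) (fun b => Utilde b i j)
        (fun _ => le_rfl) (fun b => hord b i j h.isMeshPt) (fun _ => le_rfl)
      have h₄ := mul_le_mul_of_nonneg_left (hord a _ _ h.isMeshPt_left)
        (Mesh.lC_pos (M := M) (hε a) (hv a i j h.isMeshPt)).le
      have h₅ := mul_le_mul_of_nonneg_left (hord a _ _ h.isMeshPt_right)
        (Mesh.rC_pos (M := M) (hε a)).le
      linarith
    · simp [hubbd a i j h, hlobd a i j h]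
  refine ⟨hmid, fun a i j h => ?_, fun a i j h => ?_, fun a i j h =>
    ⟨(hlobd a i j h).le, (hubbd a i j h).ge⟩⟩
  · have h₁ := hubstep a i j h
    have h₂ := hf a i j h.isMeshPt (fun b => Ubar1 b i j) (fun b => Utilde b i j)
      (fun b => (hlow b i j h.isMeshPt).trans (hmid b i j h.isMeshPt))
      (fun b => hupp b i j h.isMeshPt) (fun _ => le_rfl)
    have h₃ := mul_le_mul_of_nonneg_left (hupp a _ _ h.isMeshPt_left)
      (Mesh.lC_pos (M := M) (hε a) (hv a i j h.isMeshPt)).le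
    have h₄ := mul_le_mul_of_nonneg_left (hupp a _ _ h.isMeshPt_right)
      (Mesh.rC_pos (M := M) (hε a)).le
    simp only [Mesh.discL] at h₂ ⊢
    linarith
  · have h₁ := hlostep a i j h
    have h₂ := hf a i j h.isMeshPt (fun b => Uhat b i j) (fun b => Ulow1 b i j)
      (fun _ => le_rfl) (fun b => hlow b i j h.isMeshPt)
      (fun b => (hmid b i j h.isMeshPt).trans (hupp b i j h.isMeshPt))
    have h₃ := mul_le_mul_of_nonneg_left (hlow a _ _ h.isMeshPt_left)
      (Mesh.lC_pos (M := M) (hε a) (hv a i j h.isMeshPt)).le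
    have h₄ := mul_le_mul_of_nonneg_left (hlow a _ _ h.isMeshPt_right)
      (Mesh.rC_pos (M := M) (hε a)).le
    simp only [Mesh.discL] at h₂ ⊢
    linarith
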